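/- arXiv:1412.4840 — 8 statements merged into one kernel-verified Lean document; each statement's English description precedes it below -/
import Mathlib

section
/- For every n ≥ 2 there exist real constants C ≥ c > 0 (depending only on n) such that for every natural number T ≥ 1 there exists a dynamic (U,V) for the n×n identity matrix I_n with U(nT) = (T, T, ..., T) and c·T^((n−1)/n) ≤ gap(nT) ≤ C·T^((n−1)/n). -/
/-- A dynamic for the `n × n` identity matrix `Iₙ`: sequences `U V : ℕ → Fin n → ℕ`
starting at the zero vectors such that at each step `t` there are indices `i`, `j`
with `V i t` maximal in `V t` and `U j t` minimal in `U t`, and `U` is incremented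
by `e_i` while `V` is incremented by `e_j`. -/
def IsDynamic (n : ℕ) (U V : ℕ → Fin n → ℕ) : Prop :=
  (∀ l, U 0 l = 0) ∧ (∀ l, V 0 l = 0) ∧
  ∀ t, ∃ i j : Fin n,
    (∀ l, V t l ≤ V t i) ∧ (∀ l, U t j ≤ U t l) ∧
    (∀ l, U (t + 1) l = U t l + if l = i then 1 else 0) ∧
    (∀ l, V (t + 1) l = V t l + if l = j then 1 else 0)

/-- The duality gap of a dynamic at step `t`: `max_l V l t − min_l U l t`. -/
noncomputable def gap (n : ℕ) (U V : ℕ → Fin n → ℕ) (t : ℕ) : ℤ :=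
  ((⨆ l, V t l : ℕ) : ℤ) - ((⨅ l, U t l : ℕ) : ℤ)

/-- A pair of cumulative play counts `(U, V)`. -/
abbrev PlayState (n : ℕ) := (Fin n → ℕ) × (Fin n → ℕ)

/-- The state obtained when the row player plays `i` and the column player plays `j`. -/
def PlayState.play {n : ℕ} (s : PlayState n) (i j : Fin n) : PlayState n :=
  (fun l => s.1 l + if l = i then 1 else 0, fun l => s.2 l + if l = j then 1 else 0)

/-- One step of fictitious play on the identity matrix. -/
def PlayState.Step {n : ℕ} (s t : PlayState n) : Prop :=
  ∃ i j : Fin n, (∀ l, s.2 l ≤ s.2 i) ∧ (∀ l, s.1 j ≤ s.1 l) ∧ t = s.play i j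

/-- Reachability by finitely many steps of fictitious play. -/
abbrev PlayState.Reach {n : ℕ} : PlayState n → PlayState n → Prop :=
  Relation.ReflTransGen PlayState.Step

/-- The state with all counts zero. -/
def PlayState.zero (n : ℕ) : PlayState n := (fun _ => 0, fun _ => 0)

/-- From the zero state one can reach a state with `U = (T, …, T)` and `max V = T + h`. -/
def GapReachable (n T h : ℕ) : Prop :=
  ∃ V : Fin n → ℕ, (PlayState.zero n).Reach (fun _ => T, V) ∧
    (∀ l, V l ≤ T + h) ∧ ∃ m, V m = T + h

namespace PlayState

variable {n : ℕ}

theorem exists_step [NeZero n] (s : PlayState n) : ∃ t, s.Step t := by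
  obtain ⟨i, hi⟩ := Finite.exists_max s.2
  obtain ⟨j, hj⟩ := Finite.exists_min s.1
  exact ⟨_, i, j, hi, hj, rfl⟩

theorem Reach.exists_seq [NeZero n] {s t : PlayState n} (h : s.Reach t) :
    ∃ (f : ℕ → PlayState n) (k : ℕ), f 0 = s ∧ f k = t ∧ ∀ i, (f i).Step (f (i + 1)) := by
  induction h using Relation.ReflTransGen.head_induction_on with
  | refl =>
    choose g hg using exists_step (n := n)
    refine ⟨fun i => g^[i] t, 0, rfl, rfl, fun i => ?_⟩
    simp only [Function.iterate_succ_apply']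
    exact hg _
  | @head s _ hst _ ih =>
    obtain ⟨f, k, h0, hk, hf⟩ := ih
    refine ⟨fun i => Nat.casesOn i s f, k + 1, rfl, hk, fun i => ?_⟩
    cases i with
    | zero => simpa [h0] using hst
    | succ i => exact hf i

theorem Step.sum_fst {s t : PlayState n} (h : s.Step t) : ∑ l, t.1 l = ∑ l, s.1 l + 1 := by
  obtain ⟨i, j, -, -, rfl⟩ := h
  simp [play, Finset.sum_add_distrib]

theorem Step.sum_snd {s t : PlayState n} (h : s.Step t) : ∑ l, t.2 l = ∑ l, s.2 l + 1 := by
  obtain ⟨i, j, -, -, rfl⟩ := h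
  simp [play, Finset.sum_add_distrib]

theorem Reach.sum_eq {t : PlayState n} (h : (zero n).Reach t) : ∑ l, t.1 l = ∑ l, t.2 l := by
  induction h with
  | refl => rfl
  | tail _ hs ih => rw [hs.sum_fst, hs.sum_snd, ih]

/-- While the leader `m` of `V` is not the unique minimizer of `U`, the other coordinates of `V`
can be raised to the level of `V m`. -/
theorem reach_level (m : Fin n) (X : ℕ) (U V : Fin n → ℕ) (hU : ∀ l, l ≠ m → U l = X)
    (hm : X ≤ U m) (hV : ∀ l, V l ≤ V m) :
    ∃ Y, X ≤ Y ∧ Reach (U, V) (fun l => if l = m then Y else X, fun _ => V m) := by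
  obtain ⟨d, hd⟩ : ∃ d, d = ∑ l, (V m - V l) := ⟨_, rfl⟩
  induction d generalizing U V with
  | zero =>
    have hz : ∀ l, V l = V m := fun l => by
      have := (Finset.sum_eq_zero_iff.1 hd.symm) l (Finset.mem_univ l)
      have := hV l
      omega
    refine ⟨U m, hm, ?_⟩
    have h1 : U = fun l => if l = m then U m else X := by
      funext l
      split_ifs with h
      · rw [h]
      · exact hU l h
    have h2 : V = fun _ => V m := funext hz
    rw [← h1, ← h2]
  | succ d ih =>
    obtain ⟨l, hl⟩ : ∃ l, V l < V m := by
      by_contra! hc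
      have : ∑ l, (V m - V l) = 0 := Finset.sum_eq_zero fun l _ => Nat.sub_eq_zero_of_le (hc l)
      omega
    have hlm : l ≠ m := by rintro rfl; omega
    have hst : Step (U, V) (play (U, V) m l) := by
      refine ⟨m, l, hV, fun k => ?_, rfl⟩
      by_cases hk : k = m
      · subst hk; simpa [hU l hlm] using hm
      · simp [hU l hlm, hU k hk]
    have hVm : (play (U, V) m l).2 m = V m := by simp [play, hlm.symm]
    obtain ⟨Y, hY, hr⟩ := ih (play (U, V) m l).1 (play (U, V) m l).2
      (fun k hk => by simp [play, hk, hU k hk]) (by simp [play]; omega)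
      (fun k => by
        rw [hVm]
        by_cases hk : k = l
        · subst hk; simpa [play] using hl
        · simpa [play, hk] using hV k)
      (by
        rw [hVm]
        have h1 := Finset.add_sum_erase Finset.univ (fun k => V m - V k) (Finset.mem_univ l)
        have h2 := Finset.add_sum_erase Finset.univ (fun k => V m - (play (U, V) m l).2 k)
          (Finset.mem_univ l)
        have h3 : ∑ k ∈ Finset.univ.erase l, (V m - (play (U, V) m l).2 k) =
            ∑ k ∈ Finset.univ.erase l, (V m - V k) :=
          Finset.sum_congr rfl fun k hk => by simp [play, Finset.ne_of_mem_erase hk]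
        have h4 : (play (U, V) m l).2 l = V l + 1 := by simp [play]
        simp only [h4] at h2
        omega)
    rw [hVm] at hr
    exact ⟨Y, hY, hr.head hst⟩

/-- A dynamic on `n` coordinates can be run inside one on `n + 1` coordinates as long as the
additional coordinate `m` is not the unique minimizer of `U`. -/
theorem Reach.insertNth (m : Fin (n + 1)) (X D A : ℕ) (V : Fin n → ℕ) {s : PlayState n}
    (h : s.Reach (fun _ => D, V)) :
    (∀ l, s.1 l ≤ D) ∧
    Reach (m.insertNth (α := fun _ => ℕ) (X + D) fun l => X + s.1 l,
      m.insertNth (α := fun _ => ℕ) A fun l => A + s.2 l)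
      (fun _ => X + D, m.insertNth (α := fun _ => ℕ) A fun l => A + V l) := by
  induction h using Relation.ReflTransGen.head_induction_on with
  | refl =>
    refine ⟨fun _ => le_rfl, ?_⟩
    have : (m.insertNth (α := fun _ => ℕ) (X + D) fun _ => X + D) = fun _ => X + D := by
      funext l
      induction l using Fin.succAboveCases m <;> simp
    simp only [this]
    exact .refl
  | head hst _ ih =>
    obtain ⟨i, j, hi, hj, rfl⟩ := hst
    obtain ⟨hle, hr⟩ := ih
    have hle' : ∀ l, _ ≤ D := fun l => (Nat.le_add_right _ _).trans (hle l)
    refine ⟨hle', hr.head ⟨m.succAbove i, m.succAbove j, ?_, ?_, ?_⟩⟩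
    · rw [Fin.forall_iff_succAbove m]
      simpa using hi
    · rw [Fin.forall_iff_succAbove m]
      simpa using ⟨hle' j, hj⟩
    · refine Prod.ext (funext ?_) (funext ?_)
      all_goals
        rw [Fin.forall_iff_succAbove m]
        simp [play, Fin.ne_succAbove, add_assoc]

end PlayState

open PlayState in
/-- From a state whose `U`-coordinates other than the leader `m` of `V` agree, level `V` and then
run a dynamic on the remaining coordinates. -/
theorem GapReachable.of_leader {n X A g : ℕ} (m : Fin (n + 1)) (U V : Fin (n + 1) → ℕ)
    (hr : (zero (n + 1)).Reach (U, V)) (hU : ∀ l, l ≠ m → U l = X) (hm : X ≤ U m)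
    (hV : ∀ l, V l ≤ V m) (hA : V m = X + A) (hg : GapReachable n ((n + 1) * A) g) :
    GapReachable (n + 1) (X + (n + 1) * A) (A + g) := by
  obtain ⟨Y, hY, hr'⟩ := reach_level m X U V hU hm hV
  have hr2 := hr.trans hr'
  have hs := Reach.sum_eq hr2
  obtain ⟨W, hW, hWle, p, hp⟩ := hg
  have hYD : Y = X + (n + 1) * A := by
    rw [Fin.sum_univ_succAbove _ m, Fin.sum_univ_succAbove _ m] at hs
    simp [hA] at hs
    ring_nf at hs ⊢
    omega
  have hi := (Reach.insertNth m X ((n + 1) * A) (X + A) W hW).2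
  have hstart : ((fun l => if l = m then Y else X, fun _ => V m) : PlayState (n + 1)) =
      (m.insertNth (α := fun _ => ℕ) (X + (n + 1) * A) fun l => X + (zero n).1 l,
        m.insertNth (α := fun _ => ℕ) (X + A) fun l => (X + A) + (zero n).2 l) := by
    refine Prod.ext (funext ?_) (funext ?_)
    all_goals
      rw [Fin.forall_iff_succAbove m]
      simp [zero, hYD, hA]
  rw [hstart] at hr2
  refine ⟨_, hr2.trans hi, ?_, m.succAbove p, ?_⟩
  · rw [Fin.forall_iff_succAbove m]
    refine ⟨by simp; nlinarith, fun l => ?_⟩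
    have := hWle l
    simp
    omega
  · simp [hp]
    omega

open PlayState in
theorem GapReachable.cycle {n X h g : ℕ} (hX : GapReachable (n + 1) X h)
    (hg : GapReachable n ((n + 1) * h) g) :
    GapReachable (n + 1) (X + (n + 1) * h) (h + g) := by
  obtain ⟨V, hr, hV, m, hm⟩ := hX
  exact .of_leader m _ V hr (fun _ _ => rfl) le_rfl (fun l => hm ▸ hV l) hm hg

open PlayState in
theorem GapReachable.cycle_succ {n X h g : ℕ} (hX : GapReachable (n + 1) X h)
    (hg : GapReachable n ((n + 1) * (h + 1)) g) :
    GapReachable (n + 1) (X + (n + 1) * (h + 1)) (h + 1 + g) := by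
  obtain ⟨V, hr, hV, m, hm⟩ := hX
  refine .of_leader m _ _ (hr.tail ⟨m, m, fun l => (hV l).trans hm.ge, fun _ => le_rfl, rfl⟩)
    (X := X) ?_ ?_ ?_ ?_ hg
  · intro l hl; simp [hl]
  · simp
  · intro l
    have := hV l
    by_cases hl : l = m
    · rw [hl]
    · simp [hl]; omega
  · simp [hm, add_assoc]

open PlayState in
theorem gapReachable_one (T : ℕ) : GapReachable 1 T 0 := by
  refine ⟨fun _ => T, ?_, fun _ => le_rfl, 0, rfl⟩
  induction T with
  | zero => exact .refl
  | succ T ih =>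
    refine ih.tail ⟨0, 0, fun _ => le_rfl, fun _ => le_rfl, ?_⟩
    refine Prod.ext (funext fun l => ?_) (funext fun l => ?_)
    all_goals simp [play, Subsingleton.elim l 0]

namespace PlayState

variable {n : ℕ}

/-- Starting from the leader `p` of `V`, the lead is passed on through all of `s`, and finally the
column player plays `e`. -/
theorem reach_chain (s : Finset (Fin n)) (e : Fin n) (A m : ℕ) (he : e ∉ s) (p : Fin n)
    (U V : Fin n → ℕ) (hp : p ∉ s) (hep : e ≠ p) (hVp : V p = A) (hV : ∀ l, V l ≤ A)
    (hVs : ∀ l ∈ s, V l + 1 = A) (hUs : ∀ l ∈ s, U l = m) (hUe : U e = m)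
    (hU : ∀ l, m ≤ U l) :
    Reach (U, V) (fun l => U l + if l ∈ insert p s then 1 else 0,
      fun l => V l + if l ∈ insert e s then 1 else 0) := by
  induction s using Finset.induction_on generalizing p U V with
  | empty =>
    exact .single ⟨p, e, fun l => (hV l).trans hVp.ge, fun l => hUe.trans_le (hU l), by simp [play]⟩
  | insert x s hx ih =>
    simp only [Finset.mem_insert, not_or] at he hp
    simp only [Finset.mem_insert, forall_eq_or_imp] at hVs hUs
    have hst : Step (U, V) (play (U, V) p x) :=
      ⟨p, x, fun l => (hV l).trans hVp.ge, fun l => hUs.1.trans_le (hU l), rfl⟩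
    have := ih he.2 x (play (U, V) p x).1 (play (U, V) p x).2 hx he.1
      (by simpa [play] using hVs.1)
      (fun l => by
        by_cases h : l = x
        · subst h; simpa [play] using hVs.1.le
        · simpa [play, h] using hV l)
      (fun l hl => by
        have h : l ≠ x := by rintro rfl; exact hx hl
        simpa [play, h] using hVs.2 l hl)
      (fun l hl => by
        have h : l ≠ p := by rintro rfl; exact hp.2 hl
        simpa [play, h] using hUs.2 l hl)
      (by simpa [play, hep] using hUe)
      (fun l => (hU l).trans (Nat.le_add_right _ _))
    convert this.head hst using 1
    refine Prod.ext (funext fun l => ?_) (funext fun l => ?_)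
    · by_cases h : l = p
      · subst h; simp [play, hp]
      · simp [play, h]
    · by_cases h : l = x
      · subst h; simp [play, hx, Ne.symm he.1]
      · simp [play, h]

/-- The state where `U` exceeds `X` at `c` only and `V` exceeds `X` at `a` only is reachable. -/
def SplitReachable (n X : ℕ) : Prop :=
  ∃ a c : Fin n, a ≠ c ∧ (zero n).Reach
    (fun l => X + if l = c then 1 else 0, fun l => X + if l = a then 1 else 0)

/-- The state with `U` constantly `X + 1` and `V` equal to `X`, `X + 2` at one coordinate each and
`X + 1` elsewhere is reachable. -/
def EvenReachable (n X : ℕ) : Prop :=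
  ∃ b d : Fin n, b ≠ d ∧ (zero n).Reach
    (fun _ => X + 1, fun l => X + if l = d then 0 else if l = b then 2 else 1)

theorem SplitReachable.even {X : ℕ} (h : SplitReachable n X) : EvenReachable n X := by
  obtain ⟨a, c, hac, hr⟩ := h
  by_cases hq : ∃ q, q ≠ a ∧ q ≠ c
  · obtain ⟨q, hqa, hqc⟩ := hq
    have h1 := hr.trans <| reach_chain ({a, c, q}ᶜ) q (X + 1) X (by simp) a _ _ (by simp) hqa
      (by simp) (fun l => by split_ifs <;> omega) (fun l hl => by simp_all)
      (fun l hl => by simp_all) (by simp [hqc]) (fun l => by simp)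
    refine ⟨q, c, hqc, h1.tail ⟨q, q, fun l => ?_, fun l => ?_, Prod.ext (funext fun l => ?_)
      (funext fun l => ?_)⟩⟩
    all_goals
      simp only [play, Finset.mem_insert, Finset.mem_compl, Finset.mem_singleton]
      grind
  · replace hq : ∀ l, l = a ∨ l = c := fun l => by
      by_contra! h
      exact hq ⟨l, h⟩
    refine ⟨a, c, hac, hr.tail ⟨a, a, fun l => ?_, fun l => ?_, Prod.ext (funext fun l => ?_)
      (funext fun l => ?_)⟩⟩
    all_goals
      have := hq l
      simp only [play]
      clear hr
      grind

theorem EvenReachable.split {X : ℕ} (h : EvenReachable n X) : SplitReachable n (X + 2) := by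
  obtain ⟨b, d, hbd, hr⟩ := h
  have h1 := hr.trans <| reach_chain ({b, d}ᶜ) d (X + 2) (X + 1) (by simp) b _ _ (by simp)
    hbd.symm (by simp [hbd]) (fun l => by split_ifs <;> omega) (fun l hl => by simp_all)
    (fun l hl => rfl) rfl (fun l => le_rfl)
  simp only [Finset.mem_insert, Finset.mem_compl, Finset.mem_singleton] at h1
  have h2 := h1.tail ⟨b, d, fun l => by grind, fun l => by grind, rfl⟩
  refine ⟨d, b, hbd.symm, h2.tail ⟨d, d, fun l => ?_, fun l => ?_, Prod.ext (funext fun l => ?_)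
    (funext fun l => ?_)⟩⟩
  all_goals
    simp only [play]
    grind

theorem splitReachable_zero {a c : Fin n} (h : a ≠ c) : SplitReachable n 0 :=
  ⟨a, c, h, .single ⟨c, a, fun _ => le_rfl, fun _ => le_rfl, by simp [play, zero]⟩⟩

theorem splitReachable_one {a c : Fin n} (h : a ≠ c) : SplitReachable n 1 := by
  have h0 : (zero n).Step (play (zero n) c c) := ⟨c, c, fun _ => le_rfl, fun _ => le_rfl, rfl⟩
  have h1 := (reach_chain ({c, a}ᶜ) a 1 0 (by simp) c (play (zero n) c c).1
    (play (zero n) c c).2 (by simp) h (by simp [play, zero])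
    (fun l => by simp only [play, zero]; split_ifs <;> omega) (fun l hl => by simp_all [play, zero])
    (fun l hl => by simp_all [play, zero]) (by simp [play, zero, h]) (fun l => by simp)).head h0
  refine ⟨a, c, h, h1.tail ⟨a, a, fun l => ?_, fun l => ?_, Prod.ext (funext fun l => ?_)
    (funext fun l => ?_)⟩⟩
  all_goals
    simp only [play, zero, Finset.mem_insert, Finset.mem_compl, Finset.mem_singleton]
    grind

theorem splitReachable (hn : 2 ≤ n) (X : ℕ) : SplitReachable n X := by
  have h : (⟨0, by omega⟩ : Fin n) ≠ ⟨1, by omega⟩ := by simp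
  induction X using Nat.twoStepInduction with
  | zero => exact splitReachable_zero h
  | one => exact splitReachable_one h
  | more X ih _ => exact ih.even.split

end PlayState

open PlayState in
theorem gapReachable_gap_one {n T : ℕ} (hn : 2 ≤ n) (hT : 1 ≤ T) : GapReachable n T 1 := by
  obtain ⟨X, rfl⟩ : ∃ X, T = X + 1 := ⟨T - 1, by omega⟩
  obtain ⟨b, d, hbd, hr⟩ := (splitReachable hn X).even
  exact ⟨_, hr, fun l => by split_ifs <;> omega, b, by simp [hbd]⟩

open PlayState in
theorem GapReachable.exists_dynamic {n T h : ℕ} (hn : 2 ≤ n) (H : GapReachable n T h) :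
    ∃ U V : ℕ → Fin n → ℕ, IsDynamic n U V ∧ (∀ l, U (n * T) l = T) ∧
      gap n U V (n * T) = h := by
  have : NeZero n := ⟨by omega⟩
  obtain ⟨W, hr, hW, p, hp⟩ := H
  obtain ⟨f, k, h0, hk, hf⟩ := hr.exists_seq
  have hsum : ∀ t, ∑ l, (f t).1 l = t := by
    intro t
    induction t with
    | zero => simp [h0, zero]
    | succ t ih => rw [(hf t).sum_fst, ih]
  obtain rfl : n * T = k := by simpa [hk] using hsum k
  refine ⟨fun t => (f t).1, fun t => (f t).2, ⟨by simp [h0, zero], by simp [h0, zero], ?_⟩,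
    by simp [hk], ?_⟩
  · intro t
    obtain ⟨i, j, hi, hj, h⟩ := hf t
    exact ⟨i, j, hi, hj, by simp [h, play], by simp [h, play]⟩
  · have hsup : ⨆ l, W l = T + h :=
      le_antisymm (ciSup_le hW) (hp ▸ le_ciSup (Set.finite_range W).bddAbove p)
    simp [gap, hk, hsup]

theorem gapReachable_two (k : ℕ) : ∀ T, 1 + 4 * k ^ 2 ≤ T → GapReachable 2 T (1 + k) := by
  induction k with
  | zero => exact fun T hT => gapReachable_gap_one le_rfl (by omega)
  | succ k ih =>
    intro T hT
    have hk := ih (T - 2 * (1 + k + 1)) (by ring_nf at hT ⊢; omega)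
    have := hk.cycle_succ (n := 1) (gapReachable_one _)
    convert this using 1
    · ring_nf at hT ⊢
      omega
    · ring

theorem succ_pow_le_two_pow_mul (r m : ℕ) : (r + 1) ^ m ≤ 2 ^ m * (1 + r ^ m) := by
  rcases Nat.eq_zero_or_pos r with rfl | h
  · simpa using Nat.mul_le_mul (Nat.one_le_two_pow (n := m)) (Nat.le_add_right 1 (0 ^ m))
  · calc (r + 1) ^ m ≤ (2 * r) ^ m := by gcongr; omega
      _ = 2 ^ m * r ^ m := mul_pow _ _ _
      _ ≤ _ := by gcongr; omega

theorem succ_pow_le_add_mul (c r m : ℕ) (hc : 1 ≤ c) :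
    (r + 1) ^ (m + 1) ≤ r ^ (m + 1) + (m + 1) * (2 * c) ^ m * (1 + (r / c) ^ m) := by
  have h1 : (r + 1) ^ (m + 1) ≤ r ^ (m + 1) + (m + 1) * (r + 1) ^ m := by
    induction m with
    | zero => simp
    | succ m ih =>
      calc (r + 1) ^ (m + 1 + 1) = (r + 1) ^ (m + 1) * r + (r + 1) ^ (m + 1) := by ring
        _ ≤ (r ^ (m + 1) + (m + 1) * (r + 1) ^ m) * r + (r + 1) ^ (m + 1) := by gcongr
        _ ≤ (r ^ (m + 1) * r + (m + 1) * ((r + 1) ^ m * (r + 1))) + (r + 1) ^ (m + 1) := by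
          rw [add_mul, mul_assoc]; gcongr; omega
        _ = _ := by ring
  have h2 : r + 1 ≤ c * (r / c + 1) := Nat.lt_mul_div_succ r hc
  have h3 := succ_pow_le_two_pow_mul (r / c) m
  calc (r + 1) ^ (m + 1) ≤ r ^ (m + 1) + (m + 1) * (r + 1) ^ m := h1
    _ ≤ r ^ (m + 1) + (m + 1) * (c * (r / c + 1)) ^ m := by gcongr
    _ = r ^ (m + 1) + (m + 1) * (c ^ m * (r / c + 1) ^ m) := by rw [mul_pow]
    _ ≤ r ^ (m + 1) + (m + 1) * (c ^ m * (2 ^ m * (1 + (r / c) ^ m))) := by gcongr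
    _ = _ := by rw [mul_pow]; ring

/-- Every gap `1 + k` with `k ≤ r ^ (n - 1)` can be attained at every time `T` of order at least
`r ^ n`. -/
theorem gapReachable_of_le (m : ℕ) : ∃ c : ℕ, 1 ≤ c ∧ ∀ r k T : ℕ, k ≤ r ^ (m + 1) →
    1 + c * r ^ (m + 2) ≤ T → GapReachable (m + 2) T (1 + k) := by
  induction m with
  | zero =>
    refine ⟨4, by norm_num, fun r k T hk hT => gapReachable_two k T ?_⟩
    have : k ^ 2 ≤ r ^ 2 := Nat.pow_le_pow_left (by simpa using hk) 2
    simp only [zero_add] at hT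
    omega
  | succ m ih =>
    obtain ⟨c, hc, H⟩ := ih
    set L := (m + 2) * (2 * c) ^ (m + 1) with hL
    have hL1 : 1 ≤ L := Nat.mul_pos (by omega) (pow_pos (by omega) _)
    set K := 2 * L * (m + 3) with hK
    refine ⟨K, Nat.mul_pos (by omega) (by omega), fun r => ?_⟩
    induction r with
    | zero =>
      intro k T hk hT
      obtain rfl : k = 0 := by simpa using hk
      exact gapReachable_gap_one (by omega) (by omega)
    | succ r ihr =>
      have key : ∀ j k T : ℕ, k ≤ r ^ (m + 2) + j * (1 + (r / c) ^ (m + 1)) →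
          k ≤ (r + 1) ^ (m + 2) →
          1 + K * r ^ (m + 3) + j * ((m + 3) * (1 + (r + 1) ^ (m + 2))) ≤ T →
          GapReachable (m + 3) T (1 + k) := by
        intro j
        induction j with
        | zero =>
          intro k T hk _ hT
          exact ihr k T (by simpa using hk) (by simpa using hT)
        | succ j ihj =>
          intro k T hk hk' hT
          rw [add_mul, one_mul] at hT hk
          set G := 1 + (r / c) ^ (m + 1) with hG
          by_cases hkr : k ≤ r ^ (m + 2) + j * G
          · exact ihj k T hkr hk' (by omega)
          push Not at hkr
          obtain ⟨k₀, g, rfl, hk₀, hk₁, hg⟩ : ∃ k₀ g, k = k₀ + (1 + g) ∧ r ^ (m + 2) ≤ k₀ ∧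
              k₀ ≤ r ^ (m + 2) + j * G ∧ 1 + g ≤ G := by
            rcases le_or_gt (r ^ (m + 2) + G) k with h | h
            · exact ⟨k - G, G - 1, by omega, by omega, by omega, by omega⟩
            · refine ⟨r ^ (m + 2), k - r ^ (m + 2) - 1, ?_, le_rfl, ?_, ?_⟩
              · have := Nat.zero_le (j * G); omega
              · omega
              · have := Nat.zero_le (j * G); omega
          have hD : (m + 3) * (1 + k₀) ≤ (m + 3) * (1 + (r + 1) ^ (m + 2)) := by
            gcongr; omega
          have hsub : GapReachable (m + 2) ((m + 3) * (1 + k₀)) (1 + g) := by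
            refine H (r / c) g _ (by omega) ?_
            have h1 : c * (r / c) ^ (m + 2) ≤ r ^ (m + 2) := calc
              c * (r / c) ^ (m + 2) ≤ c ^ (m + 2) * (r / c) ^ (m + 2) := by
                gcongr; exact Nat.le_self_pow (by omega) c
              _ = (c * (r / c)) ^ (m + 2) := (mul_pow _ _ _).symm
              _ ≤ r ^ (m + 2) := by gcongr; exact Nat.mul_div_le r c
            have h2 : 1 * (1 + k₀) ≤ (m + 3) * (1 + k₀) := by gcongr; omega
            omega
          have := (ihj k₀ (T - (m + 3) * (1 + k₀)) hk₁ (by omega) (by omega)).cycle hsub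
          convert this using 1
          · show T = T - (m + 3) * (1 + k₀) + (m + 3) * (1 + k₀)
            omega
          · omega
      intro k T hk hT
      refine key L k T (hk.trans (succ_pow_le_add_mul c r (m + 1) hc)) hk (le_trans ?_ hT)
      have h1 : r ^ (m + 3) + (r + 1) ^ (m + 2) ≤ (r + 1) ^ (m + 3) := by
        rw [pow_succ r, pow_succ (r + 1) (m + 2), mul_add, mul_one]
        gcongr
        omega
      have h2 : 1 ≤ (r + 1) ^ (m + 2) := Nat.one_le_pow _ _ (by omega)
      calc 1 + K * r ^ (m + 3) + L * ((m + 3) * (1 + (r + 1) ^ (m + 2)))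
          ≤ 1 + K * r ^ (m + 3) + L * ((m + 3) * ((r + 1) ^ (m + 2) + (r + 1) ^ (m + 2))) := by
            gcongr
        _ = 1 + K * (r ^ (m + 3) + (r + 1) ^ (m + 2)) := by rw [hK]; ring
        _ ≤ 1 + K * (r + 1) ^ (m + 3) := by gcongr

/-- For every `n ≥ 2` there exist constants `C ≥ c > 0` (depending only on `n`)
such that for every `T ≥ 1` there is a dynamic `(U, V)` for `Iₙ` with
`U(nT) = (T, …, T)` and `c·T^((n−1)/n) ≤ gap(nT) ≤ C·T^((n−1)/n)`. -/
theorem stmt_4 :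
    ∀ n : ℕ, 2 ≤ n →
      ∃ c C : ℝ, 0 < c ∧ c ≤ C ∧
        ∀ T : ℕ, 1 ≤ T →
          ∃ U V : ℕ → Fin n → ℕ, IsDynamic n U V ∧
            (∀ l, U (n * T) l = T) ∧
            c * (T : ℝ) ^ (((n : ℝ) - 1) / n) ≤ (gap n U V (n * T) : ℝ) ∧
            (gap n U V (n * T) : ℝ) ≤ C * (T : ℝ) ^ (((n : ℝ) - 1) / n) := by
  intro n hn
  obtain ⟨m, rfl⟩ : ∃ m, n = m + 2 := ⟨n - 2, by omega⟩
  obtain ⟨c, hc, H⟩ := gapReachable_of_le m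
  set e : ℝ := (((m + 2 : ℕ) : ℝ) - 1) / (m + 2 : ℕ) with he
  have he0 : 0 ≤ e := by
    rw [he]; push_cast; apply div_nonneg <;> linarith [(Nat.cast_nonneg m : (0 : ℝ) ≤ m)]
  have he1 : e ≤ 1 := by
    rw [he, div_le_one (by positivity)]; linarith
  have hpow : ∀ r : ℕ, (((r : ℝ) ^ (m + 2)) ^ e) = (r : ℝ) ^ (m + 1) := by
    intro r
    rw [← Real.rpow_natCast, ← Real.rpow_mul (Nat.cast_nonneg r), he,
      mul_div_cancel₀ _ (by positivity), ← Real.rpow_natCast]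
    congr 1
    push_cast
    ring
  have hc1 : (1 : ℝ) ≤ c := by exact_mod_cast hc
  have hden : (1 : ℝ) ≤ c * 2 ^ (m + 1) := by
    have : (1 : ℝ) ≤ 2 ^ (m + 1) := one_le_pow₀ (by norm_num)
    nlinarith
  refine ⟨(c * 2 ^ (m + 1))⁻¹, 2, by positivity, (inv_le_one_of_one_le₀ hden).trans (by norm_num),
    fun T hT => ?_⟩
  obtain ⟨r, hr, hr'⟩ : ∃ r : ℕ, 1 + c * r ^ (m + 2) ≤ T ∧ T < 1 + c * (r + 1) ^ (m + 2) := by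
    have hex : ∃ r : ℕ, T < 1 + c * (r + 1) ^ (m + 2) := by
      refine ⟨T, ?_⟩
      have h1 : T + 1 ≤ (T + 1) ^ (m + 2) := Nat.le_self_pow (by omega) _
      nlinarith
    classical
    refine ⟨Nat.find hex, ?_, Nat.find_spec hex⟩
    rcases Nat.eq_zero_or_pos (Nat.find hex) with h | h
    · rw [h]; simpa using hT
    · have := Nat.find_min hex (Nat.sub_lt h one_pos)
      rw [show Nat.find hex - 1 + 1 = Nat.find hex by omega] at this
      omega
  obtain ⟨U, V, hUV, hU, hgap⟩ := (H r (r ^ (m + 1)) T le_rfl hr).exists_dynamic hn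
  refine ⟨U, V, hUV, hU, ?_, ?_⟩
  · rw [hgap, inv_mul_le_iff₀ (by positivity)]
    have h1 : (T : ℝ) ≤ c * ((r + 1 : ℕ) : ℝ) ^ (m + 2) := by
      exact_mod_cast (by omega : T ≤ c * (r + 1) ^ (m + 2))
    have h2 : ((r + 1 : ℕ) : ℝ) ^ (m + 1) ≤ 2 ^ (m + 1) * (1 + (r : ℝ) ^ (m + 1)) := by
      exact_mod_cast succ_pow_le_two_pow_mul r (m + 1)
    calc (T : ℝ) ^ e ≤ (c * ((r + 1 : ℕ) : ℝ) ^ (m + 2)) ^ e := by gcongr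
      _ = (c : ℝ) ^ e * ((r + 1 : ℕ) : ℝ) ^ (m + 1) := by
        rw [Real.mul_rpow (by positivity) (by positivity), hpow]
      _ ≤ c * (2 ^ (m + 1) * (1 + (r : ℝ) ^ (m + 1))) := by
        gcongr
        exact Real.rpow_le_self_of_one_le hc1 he1
      _ = _ := by push_cast; ring
  · rw [hgap]
    have h1 : (r : ℝ) ^ (m + 2) ≤ T := by
      have : r ^ (m + 2) ≤ c * r ^ (m + 2) := Nat.le_mul_of_pos_left _ hc
      exact_mod_cast (by omega : r ^ (m + 2) ≤ T)
    have h2 : (r : ℝ) ^ (m + 1) ≤ (T : ℝ) ^ e := by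
      rw [← hpow]
      gcongr
    have h3 : (1 : ℝ) ≤ (T : ℝ) ^ e := Real.one_le_rpow (by exact_mod_cast hT) he0
    push_cast
    linarith
end

section
/- For every natural number k ≥ 1 there exists a dynamic (U,V) for the 2×2 identity matrix I_2 such that U(2k) = (k, k) and V(2k) = (k−1, k+1). -/
/-- Relabelling the coordinates of a dynamic gives a dynamic. -/
theorem IsDynamic.comp_equiv {n : ℕ} {U V : ℕ → Fin n → ℕ} (h : IsDynamic n U V)
    (e : Fin n ≃ Fin n) : IsDynamic n (fun t l => U t (e l)) (fun t l => V t (e l)) := by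
  obtain ⟨hU, hV, hs⟩ := h
  refine ⟨fun l => hU _, fun l => hV _, fun t => ?_⟩
  obtain ⟨i, j, hi, hj, hU', hV'⟩ := hs t
  refine ⟨e.symm i, e.symm j, fun l => ?_, fun l => ?_, fun l => ?_, fun l => ?_⟩
  · simpa using hi (e l)
  · simpa using hj (e l)
  · simp [hU', Equiv.eq_symm_apply]
  · simp [hV', Equiv.eq_symm_apply]

/-- One step of fictitious play on `I₂` from `U = (a, b)`, `V = (c, d)`, encoded as
`(a, b, c, d)`; a tie in one vector is broken towards the smaller entry of the other. -/
def playStep : ℕ × ℕ × ℕ × ℕ → ℕ × ℕ × ℕ × ℕ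
  | (a, b, c, d) =>
    (if d < c ∨ c = d ∧ a ≤ b then a + 1 else a,
     if d < c ∨ c = d ∧ a ≤ b then b else b + 1,
     if a < b ∨ a = b ∧ c ≤ d then c + 1 else c,
     if a < b ∨ a = b ∧ c ≤ d then d else d + 1)

/-- The state at time `t` when the state at time `1` is `s`. -/
def playFrom (s : ℕ × ℕ × ℕ × ℕ) : ℕ → ℕ × ℕ × ℕ × ℕ
  | 0 => (0, 0, 0, 0)
  | t + 1 => playStep^[t] s

/-- The state at time `1` when `U` is first incremented at `0` and `V` at `j`. -/
def stateAfterOne (j : Fin 2) : ℕ × ℕ × ℕ × ℕ :=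
  (1, 0, if j = 0 then 1 else 0, if j = 0 then 0 else 1)

/-- The first vector of an encoded state. -/
def rowCounts (s : ℕ × ℕ × ℕ × ℕ) : Fin 2 → ℕ := ![s.1, s.2.1]

/-- The second vector of an encoded state. -/
def colCounts (s : ℕ × ℕ × ℕ × ℕ) : Fin 2 → ℕ := ![s.2.2.1, s.2.2.2]

theorem playStep_valid (s : ℕ × ℕ × ℕ × ℕ) : ∃ i j : Fin 2,
    (∀ l, colCounts s l ≤ colCounts s i) ∧ (∀ l, rowCounts s j ≤ rowCounts s l) ∧
    (∀ l, rowCounts (playStep s) l = rowCounts s l + if l = i then 1 else 0) ∧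
    (∀ l, colCounts (playStep s) l = colCounts s l + if l = j then 1 else 0) := by
  obtain ⟨a, b, c, d⟩ := s
  refine ⟨if d < c ∨ c = d ∧ a ≤ b then 0 else 1, if a < b ∨ a = b ∧ c ≤ d then 0 else 1, ?_⟩
  by_cases h : d < c ∨ c = d ∧ a ≤ b <;> by_cases h' : a < b ∨ a = b ∧ c ≤ d <;>
    simp [Fin.forall_fin_two, rowCounts, colCounts, playStep, h, h'] <;> omega

theorem isDynamic_playFrom (j : Fin 2) :
    IsDynamic 2 (fun t => rowCounts (playFrom (stateAfterOne j) t))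
      (fun t => colCounts (playFrom (stateAfterOne j) t)) := by
  refine ⟨?_, ?_, fun t => ?_⟩
  · simp [Fin.forall_fin_two, rowCounts, playFrom]
  · simp [Fin.forall_fin_two, colCounts, playFrom]
  · cases t with
    | zero =>
      refine ⟨0, j, ?_⟩
      fin_cases j <;> simp [Fin.forall_fin_two, rowCounts, colCounts, playFrom, stateAfterOne]
    | succ t =>
      simp only [playFrom, Function.iterate_succ_apply']
      exact playStep_valid _

theorem playStep_iterate_four (k : ℕ) :
    playStep^[4] (k + 1, k + 1, k, k + 2) = (k + 3, k + 3, k + 4, k + 2) := by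
  simp [playStep]

theorem playStep_iterate_four_swap (k : ℕ) :
    playStep^[4] (k + 1, k + 1, k + 2, k) = (k + 3, k + 3, k + 2, k + 4) := by
  have h : ¬(k + 1 + 1 < k ∨ k + 1 + 1 = k) := by omega
  simp [playStep, h]

theorem playStep_iterate_four_mul (k m : ℕ) :
    ∀ s, s = (k + 1, k + 1, k, k + 2) ∨ s = (k + 1, k + 1, k + 2, k) →
      playStep^[4 * m] s = (k + 2 * m + 1, k + 2 * m + 1, k + 2 * m, k + 2 * m + 2) ∨
      playStep^[4 * m] s = (k + 2 * m + 1, k + 2 * m + 1, k + 2 * m + 2, k + 2 * m) := by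
  intro s hs
  induction m with
  | zero => simpa using hs
  | succ m ih =>
    rw [show 4 * (m + 1) = 4 + 4 * m by ring, Function.iterate_add_apply]
    rcases ih with h | h
    · right
      rw [h, playStep_iterate_four]
      rfl
    · left
      rw [h, playStep_iterate_four_swap]
      rfl

theorem exists_playFrom_two_mul (k : ℕ) : ∃ j : Fin 2,
    playFrom (stateAfterOne j) (2 * (k + 1)) =
      (k + 1, k + 1, k, k + 2) ∨
    playFrom (stateAfterOne j) (2 * (k + 1)) =
      (k + 1, k + 1, k + 2, k) := by
  obtain ⟨m, rfl | rfl⟩ := Nat.even_or_odd' k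
  · refine ⟨1, ?_⟩
    rw [show 2 * (2 * m + 1) = (4 * m + 1) + 1 by ring]
    simpa [playFrom, stateAfterOne, Function.iterate_add_apply] using
      playStep_iterate_four_mul 0 m (playStep (1, 0, 0, 1)) (by simp [playStep])
  · refine ⟨0, ?_⟩
    rw [show 2 * (2 * m + 1 + 1) = (4 * m + 3) + 1 by ring]
    have h := playStep_iterate_four_mul 1 m (playStep^[3] (1, 0, 1, 0)) (by simp [playStep])
    rw [← Function.iterate_add_apply, show 1 + 2 * m = 2 * m + 1 by ring] at h
    exact h

/-- For every `k ≥ 1` there exists a dynamic `(U, V)` for `I₂` such that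
`U(2k) = (k, k)` and `V(2k) = (k−1, k+1)`. -/
theorem stmt_5 (k : ℕ) (hk : 1 ≤ k) :
    ∃ U V : ℕ → Fin 2 → ℕ, IsDynamic 2 U V ∧
      U (2 * k) 0 = k ∧ U (2 * k) 1 = k ∧
      V (2 * k) 0 = k - 1 ∧ V (2 * k) 1 = k + 1 := by
  obtain ⟨k, rfl⟩ := Nat.exists_eq_add_of_le' hk
  obtain ⟨j, h | h⟩ := exists_playFrom_two_mul k
  · refine ⟨_, _, isDynamic_playFrom j, ?_⟩
    simp only [h]
    simp [rowCounts, colCounts]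
  · refine ⟨_, _, (isDynamic_playFrom j).comp_equiv (Equiv.swap 0 1), ?_⟩
    simp only [h]
    simp [rowCounts, colCounts]
end

section
/- There exists a single dynamic (U,V) for the 2×2 identity matrix I_2 such that for every odd natural number k ≥ 1, U(2k) = (k, k) and the multiset of components of V(2k) equals {k−1, k+1}. -/
/-- The number of times the first coordinate of `V` has been incremented before step `t`: from step
`2` on, runs of four increments alternate with runs of four steps without increment. -/
def blockCount (t : ℕ) : ℕ := 4 * ((t - 2) / 8) + min ((t - 2) % 8) 4

/-- The number of times the first coordinate of `U` has been incremented before step `t`. -/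
def delayedBlockCount (t : ℕ) : ℕ := min t (1 + blockCount (t - 2))

/-- A pair of counters, each incremented at most once per step, gives a dynamic for `I₂` as soon as
every increment is a best response. -/
theorem isDynamic_two_of_counts (u v : ℕ → ℕ) (hu0 : u 0 = 0) (hv0 : v 0 = 0)
    (hut : ∀ t, u t ≤ t) (hvt : ∀ t, v t ≤ t)
    (hu : ∀ t, u (t + 1) = u t + 1 ∧ t ≤ 2 * v t ∨ u (t + 1) = u t ∧ 2 * v t ≤ t)
    (hv : ∀ t, v (t + 1) = v t + 1 ∧ 2 * u t ≤ t ∨ v (t + 1) = v t ∧ t ≤ 2 * u t) :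
    IsDynamic 2 (fun t => ![u t, t - u t]) (fun t => ![v t, t - v t]) := by
  refine ⟨by simp [Fin.forall_fin_two, hu0], by simp [Fin.forall_fin_two, hv0], fun t => ?_⟩
  have hut := hut t
  have hvt := hvt t
  rcases hu t with ⟨hu, hu'⟩ | ⟨hu, hu'⟩ <;> rcases hv t with ⟨hv, hv'⟩ | ⟨hv, hv'⟩
  · refine ⟨0, 0, ?_⟩
    simp [Fin.forall_fin_two, hu, hv]
    omega
  · refine ⟨0, 1, ?_⟩
    simp [Fin.forall_fin_two, hu, hv]
    omega
  · refine ⟨1, 0, ?_⟩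
    simp [Fin.forall_fin_two, hu, hv]
    omega
  · refine ⟨1, 1, ?_⟩
    simp [Fin.forall_fin_two, hu, hv]
    omega

/-- There exists a single dynamic `(U, V)` for `I₂` such that for every odd `k ≥ 1`,
`U(2k) = (k, k)` and the multiset of components of `V(2k)` is `{k−1, k+1}`. -/
theorem stmt_7 :
    ∃ U V : ℕ → Fin 2 → ℕ, IsDynamic 2 U V ∧
      ∀ k : ℕ, 1 ≤ k → Odd k →
        U (2 * k) 0 = k ∧ U (2 * k) 1 = k ∧
        ({V (2 * k) 0, V (2 * k) 1} : Multiset ℕ) = {k - 1, k + 1} := by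
  refine ⟨_, _, isDynamic_two_of_counts delayedBlockCount blockCount rfl rfl ?_ ?_ ?_ ?_, ?_⟩
  · intro t
    exact min_le_left _ _
  · intro t
    unfold blockCount
    omega
  · intro t
    unfold delayedBlockCount blockCount
    omega
  · intro t
    unfold delayedBlockCount blockCount
    omega
  · rintro k - ⟨m, rfl⟩
    have hU : delayedBlockCount (2 * (2 * m + 1)) = 2 * m + 1 := by
      unfold delayedBlockCount blockCount
      omega
    have hV : blockCount (2 * (2 * m + 1)) = 2 * m ∨
        blockCount (2 * (2 * m + 1)) = 2 * m + 2 := by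
      unfold blockCount
      omega
    refine ⟨by simp [hU], by simp [hU]; omega, ?_⟩
    rcases hV with hV | hV
    · have h : 2 * (2 * m + 1) - 2 * m = 2 * m + 2 := by omega
      simp [hV, h]
    · have h : 2 * (2 * m + 1) - (2 * m + 2) = 2 * m := by omega
      simpa [hV, h] using Multiset.pair_comm (2 * m + 2) (2 * m)
end

section
/- There exists a single dynamic (U,V) for the 2×2 identity matrix I_2 such that for every even natural number k ≥ 2, U(2k) = (k, k) and the multiset of components of V(2k) equals {k−1, k+1}. -/
/-- There exists a single dynamic `(U, V)` for `I₂` such that for every even `k ≥ 2`,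
`U(2k) = (k, k)` and the multiset of components of `V(2k)` is `{k−1, k+1}`. -/
theorem stmt_8 :
    ∃ U V : ℕ → Fin 2 → ℕ, IsDynamic 2 U V ∧
      ∀ k : ℕ, 2 ≤ k → Even k →
        U (2 * k) 0 = k ∧ U (2 * k) 1 = k ∧
        ({V (2 * k) 0, V (2 * k) 1} : Multiset ℕ) = {k - 1, k + 1} := by
  refine ⟨fun t => ![4 * (t / 8) + min (t % 8) 2 + (t % 8 - 6),
      4 * (t / 8) + min (t % 8 - 2) 4],
    fun t => ![if t = 0 then 0 else 4 * (t / 8) + 1 + (t % 8 - 4),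
      4 * (t / 8) + min (t % 8) 4 - 1], ⟨?_, ?_, fun t => ?_⟩, ?_⟩
  · simp [Fin.forall_fin_two]
  · simp [Fin.forall_fin_two]
  · refine ⟨if 2 ≤ t % 8 ∧ t % 8 ≤ 5 then 1 else 0,
      if t = 0 ∨ 4 ≤ t % 8 then 0 else 1, ?_⟩
    have h_div : (t + 1) / 8 = t / 8 + (t % 8 + 1) / 8 := by omega
    have h_mod : (t + 1) % 8 = (t % 8 + 1) % 8 := by omega
    have h_zero : t = 0 ↔ t / 8 = 0 ∧ t % 8 = 0 := by omega
    have hr : t % 8 < 8 := Nat.mod_lt _ (by norm_num)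
    simp only [Fin.forall_fin_two, Matrix.cons_val_zero, Matrix.cons_val_one, h_div, h_mod,
      h_zero, Nat.add_eq_zero_iff, one_ne_zero, and_false, if_false]
    generalize t / 8 = q
    generalize t % 8 = r at hr
    clear h_div h_mod h_zero
    by_cases hq : q = 0 <;> interval_cases r <;> simp [hq] <;> omega
  · intro k hk hk_even
    obtain ⟨a, rfl⟩ := hk_even
    simp only [Matrix.cons_val_zero, Matrix.cons_val_one]
    refine ⟨by omega, by omega, ?_⟩
    rw [if_neg (by omega)]
    rcases Nat.even_or_odd' a with ⟨b, rfl | rfl⟩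
    · rw [Multiset.pair_comm]
      congr 1
      · omega
      · congr 1
        omega
    · congr 1
      · omega
      · congr 1
        omega
end

section
/- For every n ≥ 3 and every natural number k ≥ 1 there exists a dynamic (U,V) for the n×n identity matrix I_n such that U(nk) = (k, k, ..., k) and V(nk) = (k−1, k, ..., k, k+1) (first component k−1, last component k+1, all middle components k). -/
/-- One step of fictitious play on the identity matrix, between pairs `(U, V)`. -/
def PlayStep {n : ℕ} (s s' : (Fin n → ℕ) × (Fin n → ℕ)) : Prop :=
  ∃ i j : Fin n, (∀ l, s.2 l ≤ s.2 i) ∧ (∀ l, s.1 j ≤ s.1 l) ∧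
    (∀ l, s'.1 l = s.1 l + if l = i then 1 else 0) ∧
    (∀ l, s'.2 l = s.2 l + if l = j then 1 else 0)

/-- Reachability under finitely many steps of fictitious play. -/
abbrev PlayReach {n : ℕ} : (Fin n → ℕ) × (Fin n → ℕ) → (Fin n → ℕ) × (Fin n → ℕ) → Prop :=
  Relation.ReflTransGen PlayStep

lemma PlayReach.of_step {n : ℕ} {U V U' V' : Fin n → ℕ} (i j : Fin n)
    (hi : ∀ l, V l ≤ V i) (hj : ∀ l, U j ≤ U l)
    (hU : ∀ l, U' l = U l + if l = i then 1 else 0)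
    (hV : ∀ l, V' l = V l + if l = j then 1 else 0) : PlayReach (U, V) (U', V') :=
  .single ⟨i, j, hi, hj, hU, hV⟩

lemma exists_playStep {n : ℕ} [NeZero n] (s : (Fin n → ℕ) × (Fin n → ℕ)) :
    ∃ s', PlayStep s s' := by
  obtain ⟨i, hi⟩ := Finite.exists_max s.2
  obtain ⟨j, hj⟩ := Finite.exists_min s.1
  exact ⟨(fun l => s.1 l + if l = i then 1 else 0, fun l => s.2 l + if l = j then 1 else 0),
    i, j, hi, hj, fun _ => rfl, fun _ => rfl⟩

/-- A finite play extends to an infinite one. -/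
lemma PlayReach.exists_sequence {n : ℕ} [NeZero n] {s s' : (Fin n → ℕ) × (Fin n → ℕ)}
    (h : PlayReach s s') :
    ∃ f : ℕ → (Fin n → ℕ) × (Fin n → ℕ),
      f 0 = s ∧ (∀ t, PlayStep (f t) (f (t + 1))) ∧ ∃ t, f t = s' := by
  induction h using Relation.ReflTransGen.head_induction_on with
  | refl =>
    choose next hnext using exists_playStep (n := n)
    refine ⟨fun t => next^[t] s', rfl, fun t => ?_, 0, rfl⟩
    simp only [Function.iterate_succ_apply']
    exact hnext _
  | head hstep _ ih =>
    rename_i a b _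
    obtain ⟨f, h0, hf, t, ht⟩ := ih
    refine ⟨fun t => Nat.casesOn t a f, rfl, fun t => ?_, t + 1, ht⟩
    cases t with
    | zero =>
      change PlayStep a (f 0)
      rwa [h0]
    | succ t => exact hf t

/-- At time `t` the entries of `U t` sum to `t`. -/
lemma IsDynamic.sum_eq {n : ℕ} {U V : ℕ → Fin n → ℕ} (h : IsDynamic n U V) (t : ℕ) :
    ∑ l, U t l = t := by
  induction t with
  | zero => simp [h.1]
  | succ t ih =>
    obtain ⟨i, j, -, -, hU, -⟩ := h.2.2 t
    simp [hU, Finset.sum_add_distrib, ih]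

/-- Starting at a maximizer `c` of `V`, the play can pass once through all elements of `S` and end
by incrementing `V` at `y`, when `U` is minimal and `V` is one below its maximum on `S ∪ {y}`. -/
lemma PlayReach.sweep {n : ℕ} (S : Finset (Fin n)) :
    ∀ {U V : Fin n → ℕ} (c y : Fin n), c ∉ S → y ∉ S → c ≠ y → (∀ l, V l ≤ V c) →
      (∀ x, x = y ∨ x ∈ S → V x + 1 = V c ∧ ∀ l, U x ≤ U l) →
      PlayReach (U, V) (fun l => U l + if l = c ∨ l ∈ S then 1 else 0,
        fun l => V l + if l = y ∨ l ∈ S then 1 else 0) := by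
  induction S using Finset.induction_on with
  | empty =>
    intro U V c y _ _ _ hc hS
    exact PlayReach.of_step c y hc (hS y (by simp)).2 (by simp) (by simp)
  | insert x S hx ih =>
    intro U V c y hcS hyS hcy hc hS
    simp only [Finset.mem_insert, not_or] at hcS hyS hS
    have hxS := hS x (by simp)
    have hstep : PlayReach (U, V) (fun l => U l + if l = c then 1 else 0,
        fun l => V l + if l = x then 1 else 0) :=
      PlayReach.of_step c x hc hxS.2 (fun _ => rfl) (fun _ => rfl)
    refine hstep.trans ?_
    have hrest := ih (U := fun l => U l + if l = c then 1 else 0)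
      (V := fun l => V l + if l = x then 1 else 0) x y hx hyS.2 (Ne.symm hyS.1) ?_ ?_
    · have hU : (fun l => U l + if l = c ∨ l ∈ insert x S then 1 else 0) =
          fun l => (U l + if l = c then 1 else 0) + if l = x ∨ l ∈ S then 1 else 0 := by
        funext l
        by_cases h : l = c
        · subst h
          simp [hcS]
        · simp [h]
      have hV : (fun l => V l + if l = y ∨ l ∈ insert x S then 1 else 0) =
          fun l => (V l + if l = x then 1 else 0) + if l = y ∨ l ∈ S then 1 else 0 := by
        funext l
        by_cases h : l = x
        · subst h
          simp [hx, Ne.symm hyS.1]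
        · simp [h]
      rw [hU, hV]
      exact hrest
    · intro l
      have hl := hc l
      have hx1 := hxS.1
      by_cases h : l = x
      · simp [h]
      · simp only [h, if_false, if_true]
        omega
    · intro w hw
      have hwS := hS w (by tauto)
      have hwx : w ≠ x := by grind
      have hwc : w ≠ c := by grind
      refine ⟨?_, fun l => ?_⟩
      · have hx1 := hxS.1
        simp only [hwx, if_false, if_true]
        omega
      · simp only [hwc, if_false]
        exact le_add_right (hwS.2 l)

/-- The state with `U` constant equal to `k + 1` and `V` below at `a` and above at `z`. -/
def tiltedV {n : ℕ} (k : ℕ) (a z : Fin n) : (Fin n → ℕ) × (Fin n → ℕ) :=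
  (fun _ => k + 1, fun l => if l = a then k else if l = z then k + 2 else k + 1)

/-- The state with `V` constant equal to `k + 1` and `U` above at `p` and below at `q`. -/
def tiltedU {n : ℕ} (k : ℕ) (p q : Fin n) : (Fin n → ℕ) × (Fin n → ℕ) :=
  (fun l => if l = p then k + 2 else if l = q then k else k + 1, fun _ => k + 1)

lemma exists_ne_ne {n : ℕ} (hn : 3 ≤ n) (a b : Fin n) : ∃ x, x ≠ a ∧ x ≠ b := by
  have h : ({a, b} : Finset (Fin n)).card < (Finset.univ : Finset (Fin n)).card := by
    have := Finset.card_le_two (a := a) (b := b)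
    simp only [Finset.card_univ, Fintype.card_fin]
    omega
  obtain ⟨x, -, hx⟩ := Finset.exists_mem_notMem_of_card_lt_card h
  exact ⟨x, by simpa using hx⟩

lemma playReach_zero_tiltedV {n : ℕ} (hn : 3 ≤ n) {a z : Fin n} (haz : a ≠ z) :
    PlayReach (fun _ => 0, fun _ => 0) (tiltedV 0 a z) := by
  obtain ⟨x, hxa, hxz⟩ := exists_ne_ne hn a z
  have h₁ : PlayReach (n := n) (fun _ => 0, fun _ => 0)
      (fun l => if l = a then 1 else 0, fun l => if l = x then 1 else 0) :=
    PlayReach.of_step a x (by simp) (by simp) (by simp) (by simp)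
  refine (h₁.trans (PlayReach.sweep (Finset.univ \ {a, x, z}) x z (by simp) (by simp) hxz
    (by grind) (by grind))).trans (PlayReach.of_step z z ?_ ?_ ?_ ?_) <;>
    intro l <;> simp <;> grind

lemma playReach_zero_tiltedU {n : ℕ} {p q : Fin n} (hpq : p ≠ q) :
    PlayReach (fun _ => 0, fun _ => 0) (tiltedU 0 p q) := by
  have h₁ : PlayReach (n := n) (fun _ => 0, fun _ => 0)
      (fun l => if l = p then 1 else 0, fun l => if l = p then 1 else 0) :=
    PlayReach.of_step p p (by simp) (by simp) (by simp) (by simp)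
  convert h₁.trans (PlayReach.sweep (Finset.univ \ {p, q}) p q (by simp) (by simp) hpq
    (by grind) (by grind)) using 1
  unfold tiltedU
  congr 1 <;> funext l <;> simp <;> grind

lemma playReach_tiltedV_tiltedU {n : ℕ} (k : ℕ) {a z q : Fin n} (haz : a ≠ z) (hqa : q ≠ a)
    (hqz : q ≠ z) : PlayReach (tiltedV k a z) (tiltedU (k + 1) z q) := by
  have h₁ : PlayReach (tiltedV k a z)
      (fun l => if l = z then k + 2 else k + 1, fun l => if l = z then k + 2 else k + 1) :=
    PlayReach.of_step z a (by grind) (by grind) (by grind) (by grind)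
  have h₂ : PlayReach (n := n)
      (fun l => if l = z then k + 2 else k + 1, fun l => if l = z then k + 2 else k + 1)
      (fun l => if l = z then k + 3 else k + 1, fun l => if l = z ∨ l = a then k + 2 else k + 1) :=
    PlayReach.of_step z a (by grind) (by grind) (by grind) (by grind)
  convert (h₁.trans h₂).trans (PlayReach.sweep (Finset.univ \ {a, z, q}) a q (by simp) (by simp) hqa.symm
    (by grind) (by grind)) using 1
  unfold tiltedU
  congr 1 <;> funext l <;> simp <;> grind

lemma playReach_tiltedU_tiltedV {n : ℕ} (k : ℕ) {p q z : Fin n} (hpq : p ≠ q) (hzp : z ≠ p)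
    (hzq : z ≠ q) : PlayReach (tiltedU k p q) (tiltedV (k + 1) p z) := by
  have h₁ : PlayReach (tiltedU k p q)
      (fun l => if l = p then k + 2 else k + 1, fun l => if l = q then k + 2 else k + 1) :=
    PlayReach.of_step q q (by grind) (by grind) (by grind) (by grind)
  refine (h₁.trans (PlayReach.sweep (Finset.univ \ {p, q, z}) q z (by simp) (by simp) hzq.symm
    (by grind) (by grind))).trans (PlayReach.of_step z z ?_ ?_ ?_ ?_) <;>
    intro l <;> simp <;> grind

lemma playReach_zero_tilted {n : ℕ} (hn : 3 ≤ n) (k : ℕ) :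
    ∀ {a z : Fin n}, a ≠ z → PlayReach (fun _ => 0, fun _ => 0) (tiltedV k a z) ∧
      PlayReach (fun _ => 0, fun _ => 0) (tiltedU k a z) := by
  induction k with
  | zero => exact fun h => ⟨playReach_zero_tiltedV hn h, playReach_zero_tiltedU h⟩
  | succ k ih =>
    intro a z haz
    obtain ⟨x, hxa, hxz⟩ := exists_ne_ne hn a z
    exact ⟨(ih hxa.symm).2.trans (playReach_tiltedU_tiltedV k hxa.symm haz.symm hxz.symm),
      (ih hxa).1.trans (playReach_tiltedV_tiltedU k hxa hxz.symm haz.symm)⟩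

/-- For every `n ≥ 3` and every `k ≥ 1` there exists a dynamic `(U, V)` for `Iₙ`
such that `U(nk) = (k, …, k)` and `V(nk) = (k−1, k, …, k, k+1)` (first component
`k−1`, last component `k+1`, all middle components `k`). -/
theorem stmt_9 (n k : ℕ) (hn : 3 ≤ n) (hk : 1 ≤ k) :
    ∃ U V : ℕ → Fin n → ℕ, IsDynamic n U V ∧
      (∀ l, U (n * k) l = k) ∧
      V (n * k) ⟨0, by omega⟩ = k - 1 ∧
      V (n * k) ⟨n - 1, by omega⟩ = k + 1 ∧
      (∀ l : Fin n, (l : ℕ) ≠ 0 → (l : ℕ) ≠ n - 1 → V (n * k) l = k) := by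
  have : NeZero n := ⟨by omega⟩
  obtain ⟨k, rfl⟩ := Nat.exists_eq_add_of_le' hk
  have hne : (⟨0, by omega⟩ : Fin n) ≠ ⟨n - 1, by omega⟩ := by
    simp only [ne_eq, Fin.mk.injEq]
    omega
  obtain ⟨f, h0, hf, t, ht⟩ := (playReach_zero_tilted hn k hne).1.exists_sequence
  have hdyn : IsDynamic n (fun t => (f t).1) (fun t => (f t).2) :=
    ⟨by simp [h0], by simp [h0], hf⟩
  have htime : n * (k + 1) = t := by
    have := hdyn.sum_eq t
    simpa [ht, tiltedV] using this
  refine ⟨_, _, hdyn, ?_⟩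
  simp only [htime, ht, tiltedV, Fin.ext_iff]
  refine ⟨fun _ => trivial, by simp, ?_, fun l h h' => by simp [h, h']⟩
  rw [if_neg (by omega), if_pos trivial]
end

section
/- Let n ≥ 2, let (U,V) be a dynamic for the n×n identity matrix I_n, and let P be a natural number with U(nP) = (P, P, ..., P). Set M = max_l V_l(nP) and let i* be an index with V_{i*}(nP) = M. Then there exists a dynamic (U',V') for I_n agreeing with (U,V) at every step ≤ nP such that U'(nM) equals P in every component except component i*, where it equals P + n(M − P), and V'(nM) = (M, M, ..., M). -/
/-- In a dynamic for `Iₙ`, the components of `V t` sum to `t`. -/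
theorem IsDynamic.sum_V {n : ℕ} {U V : ℕ → Fin n → ℕ} (h : IsDynamic n U V) (t : ℕ) :
    ∑ l, V t l = t := by
  induction t with
  | zero => simp [h.2.1]
  | succ t ih =>
    obtain ⟨i, j, -, -, -, hV⟩ := h.2.2 t
    simp [hV, Finset.sum_add_distrib, ih]

/-- A dynamic can be continued from step `T` by any legal selection rules: `I` for the
increments of `U` and `J` for those of `V`, both depending on the current state. -/
theorem IsDynamic.exists_continuation {n : ℕ} {U V : ℕ → Fin n → ℕ} (h : IsDynamic n U V)
    (T : ℕ) (I J : (Fin n → ℕ) → (Fin n → ℕ) → Fin n)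
    (hI : ∀ (u v : Fin n → ℕ) l, v l ≤ v (I u v))
    (hJ : ∀ (u v : Fin n → ℕ) l, u (J u v) ≤ u l) :
    ∃ U' V' : ℕ → Fin n → ℕ, IsDynamic n U' V' ∧
      (∀ t, t ≤ T → U' t = U t ∧ V' t = V t) ∧
      ∀ k,
        (∀ l, U' (T + k + 1) l =
          U' (T + k) l + if l = I (U' (T + k)) (V' (T + k)) then 1 else 0) ∧
        (∀ l, V' (T + k + 1) l =
          V' (T + k) l + if l = J (U' (T + k)) (V' (T + k)) then 1 else 0) := by
  let next : (Fin n → ℕ) × (Fin n → ℕ) → (Fin n → ℕ) × (Fin n → ℕ) := fun s =>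
    (fun l => s.1 l + if l = I s.1 s.2 then 1 else 0,
     fun l => s.2 l + if l = J s.1 s.2 then 1 else 0)
  let S : ℕ → (Fin n → ℕ) × (Fin n → ℕ) := fun t =>
    if t ≤ T then (U t, V t) else next^[t - T] (U T, V T)
  have hle : ∀ t, t ≤ T → S t = (U t, V t) := fun t ht => if_pos ht
  have hge : ∀ k, S (T + k) = next^[k] (U T, V T) := by
    intro k
    rcases Nat.eq_zero_or_pos k with rfl | hk
    · exact hle T le_rfl
    · simp only [S]
      rw [if_neg (by omega), Nat.add_sub_cancel_left]
  have hsucc : ∀ k, S (T + k + 1) = next (S (T + k)) := by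
    intro k
    rw [add_assoc, hge, hge, Function.iterate_succ_apply']
  refine ⟨fun t => (S t).1, fun t => (S t).2, ⟨fun l => ?_, fun l => ?_, fun t => ?_⟩,
    fun t ht => ?_, fun k => ⟨fun l => ?_, fun l => ?_⟩⟩
  · simp [hle 0 (Nat.zero_le T), h.1]
  · simp [hle 0 (Nat.zero_le T), h.2.1]
  · rcases lt_or_ge t T with ht | ht
    · simpa only [hle t ht.le, hle (t + 1) ht] using h.2.2 t
    · obtain ⟨k, rfl⟩ := Nat.exists_eq_add_of_le ht
      refine ⟨I (S (T + k)).1 (S (T + k)).2, J (S (T + k)).1 (S (T + k)).2,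
        hI _ _, hJ _ _, fun l => ?_, fun l => ?_⟩ <;> simp only [hsucc, next]
  · simp only [hle t ht, and_self]
  · simp only [hsucc, next]
  · simp only [hsucc, next]

/-- There is a rule selecting a maximal index of each vector, which selects `a` whenever `a` is
maximal. -/
theorem exists_argmax_rule {n : ℕ} (a : Fin n) :
    ∃ I : (Fin n → ℕ) → Fin n, (∀ (v : Fin n → ℕ) l, v l ≤ v (I v)) ∧
      ∀ v : Fin n → ℕ, (∀ l, v l ≤ v a) → I v = a := by
  have key : ∀ v : Fin n → ℕ, ∃ i, (∀ l, v l ≤ v i) ∧ ((∀ l, v l ≤ v a) → i = a) := by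
    intro v
    by_cases ha : ∀ l, v l ≤ v a
    · exact ⟨a, ha, fun _ => rfl⟩
    · have : Nonempty (Fin n) := ⟨a⟩
      obtain ⟨i, hi⟩ := Finite.exists_max v
      exact ⟨i, hi, fun h => absurd h ha⟩
  choose I hI using key
  exact ⟨I, fun v => (hI v).1, fun v => (hI v).2⟩

/-- There is a rule selecting a minimal index of `u`, which selects one satisfying `p v`
whenever some minimal index does. -/
theorem exists_argmin_rule {n : ℕ} [Nonempty (Fin n)] (p : (Fin n → ℕ) → Fin n → Prop) :
    ∃ J : (Fin n → ℕ) → (Fin n → ℕ) → Fin n, (∀ (u v : Fin n → ℕ) l, u (J u v) ≤ u l) ∧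
      ∀ u v : Fin n → ℕ, (∃ j, (∀ l, u j ≤ u l) ∧ p v j) → p v (J u v) := by
  have key : ∀ u v : Fin n → ℕ, ∃ j, (∀ l, u j ≤ u l) ∧
      ((∃ j, (∀ l, u j ≤ u l) ∧ p v j) → p v j) := by
    intro u v
    by_cases h : ∃ j, (∀ l, u j ≤ u l) ∧ p v j
    · obtain ⟨j, hj, hp⟩ := h
      exact ⟨j, hj, fun _ => hp⟩
    · obtain ⟨j, hj⟩ := Finite.exists_min u
      exact ⟨j, hj, fun h' => absurd h' h⟩
  choose J hJ using key
  exact ⟨J, fun u v => (hJ u v).1, fun u v => (hJ u v).2⟩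

/-- Let `n ≥ 2`, let `(U, V)` be a dynamic for `Iₙ`, and let `P` satisfy
`U(nP) = (P, …, P)`. Set `M = max_l V_l(nP)`, attained at index `i⋆`. Then there
is a dynamic `(U', V')` for `Iₙ` agreeing with `(U, V)` at every step `≤ nP`,
with `U'(nM)` equal to `P` in every component except `i⋆`, where it equals
`P + n(M − P)`, and with `V'(nM) = (M, …, M)`. -/
theorem stmt_11 (n : ℕ) (hn : 2 ≤ n) (U V : ℕ → Fin n → ℕ)
    (hUV : IsDynamic n U V) (P : ℕ) (hP : ∀ l, U (n * P) l = P)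
    (M : ℕ) (istar : Fin n) (hmax : ∀ l, V (n * P) l ≤ V (n * P) istar)
    (hM : V (n * P) istar = M) :
    ∃ U' V' : ℕ → Fin n → ℕ, IsDynamic n U' V' ∧
      (∀ t, t ≤ n * P → ∀ l, U' t l = U t l ∧ V' t l = V t l) ∧
      (∀ l, l ≠ istar → U' (n * M) l = P) ∧
      U' (n * M) istar = P + n * (M - P) ∧
      (∀ l, V' (n * M) l = M) := by
  have hne : Nonempty (Fin n) := ⟨istar⟩
  obtain ⟨I, hI, hIstar⟩ := exists_argmax_rule istar
  obtain ⟨J, hJ, hJlt⟩ := exists_argmin_rule (n := n) fun v j => v j < M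
  obtain ⟨U', V', hdyn, hagree, hstep⟩ :=
    hUV.exists_continuation (n * P) (fun _ v => I v) J (fun _ => hI) hJ
  have hPM : P ≤ M := by
    have hsum : ∑ l, V (n * P) l ≤ ∑ _l : Fin n, M :=
      Finset.sum_le_sum fun l _ => hM ▸ hmax l
    rw [hUV.sum_V, Finset.sum_const, Finset.card_univ, Fintype.card_fin, smul_eq_mul] at hsum
    exact Nat.le_of_mul_le_mul_left hsum (by omega)
  have hnM : n * P + n * (M - P) = n * M := by
    rw [← Nat.mul_add, Nat.add_sub_cancel' hPM]
  have hinv : ∀ k, k ≤ n * (M - P) →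
      (∀ l, U' (n * P + k) l = P + if l = istar then k else 0) ∧
      (∀ l, V' (n * P + k) l ≤ M) ∧ V' (n * P + k) istar = M := by
    intro k
    induction k with
    | zero =>
      intro _
      obtain ⟨h₁, h₂⟩ := hagree (n * P) le_rfl
      simp only [add_zero, h₁, h₂]
      exact ⟨fun l => by simp [hP], fun l => hM ▸ hmax l, hM⟩
    | succ k ih =>
      intro hk
      obtain ⟨hu, hv, hvs⟩ := ih (by omega)
      obtain ⟨hsU, hsV⟩ := hstep k
      have hi : I (V' (n * P + k)) = istar := hIstar _ fun l => hvs ▸ hv l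
      have hj : V' (n * P + k) (J (U' (n * P + k)) (V' (n * P + k))) < M := by
        apply hJlt
        obtain ⟨j, -, hj⟩ : ∃ j ∈ Finset.univ, V' (n * P + k) j < M := by
          apply Finset.exists_lt_of_sum_lt
          rw [hdyn.sum_V, Finset.sum_const, Finset.card_univ, Fintype.card_fin, smul_eq_mul]
          omega
        have hjs : j ≠ istar := by
          rintro rfl
          omega
        exact ⟨j, fun l => by simp [hu, hjs], hj⟩
      rw [← add_assoc]
      refine ⟨fun l => ?_, fun l => ?_, ?_⟩
      · rw [hsU, hi, hu]
        split_ifs <;> omega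
      · rw [hsV]
        have := hv l
        split_ifs with h
        · subst h
          omega
        · omega
      · have hne' : istar ≠ J (U' (n * P + k)) (V' (n * P + k)) := by
          intro h
          rw [← h] at hj
          omega
        rw [hsV, if_neg hne', hvs, add_zero]
  obtain ⟨hu, hv, -⟩ := hinv _ le_rfl
  rw [hnM] at hu hv
  refine ⟨U', V', hdyn, fun t ht l => ?_, fun l hl => ?_, ?_, fun l => ?_⟩
  · obtain ⟨h₁, h₂⟩ := hagree t ht
    rw [h₁, h₂]
    exact ⟨rfl, rfl⟩
  · simp [hu, hl]
  · simp [hu]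
  · have hsum : ∑ l, V' (n * M) l = ∑ _l : Fin n, M := by
      simp [hdyn.sum_V]
    exact (Finset.sum_eq_sum_iff_of_le fun l _ => hv l).1 hsum l (Finset.mem_univ l)
end

section
/- Let n ≥ 2 and let (U,V) be a dynamic for the (n+1)×(n+1) identity matrix I_{n+1} such that at some step t₀: V(t₀) = (Q, Q, ..., Q) is constant, and U(t₀) equals P in its first n components and P + R in its last component, for natural numbers P, Q, R. Let (Û,V̂) be any dynamic for the n×n identity matrix I_n and s₀ a natural number such that every component of Û(s) is at most R for all s ≤ s₀. Then there exists a dynamic (U',V') for I_{n+1} agreeing with (U,V) at every step ≤ t₀ and satisfying, for all 0 ≤ s ≤ s₀ and all i ≤ n: U'_i(t₀+s) = P + Û_i(s), V'_i(t₀+s) = Q + V̂_i(s), U'_{n+1}(t₀+s) = P + R, and V'_{n+1}(t₀+s) = Q. -/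
/-- One step of fictitious play on the identity matrix, from the state `(u, v)` to `(u', v')`. -/
def IsStep {n : ℕ} (u v u' v' : Fin n → ℕ) : Prop :=
  ∃ i j : Fin n, (∀ l, v l ≤ v i) ∧ (∀ l, u j ≤ u l) ∧
    (∀ l, u' l = u l + if l = i then 1 else 0) ∧
    (∀ l, v' l = v l + if l = j then 1 else 0)

/-- From every state some step is possible. -/
lemma exists_isStep {n : ℕ} [NeZero n] (x : (Fin n → ℕ) × (Fin n → ℕ)) :
    ∃ y : (Fin n → ℕ) × (Fin n → ℕ), IsStep x.1 x.2 y.1 y.2 := by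
  obtain ⟨i, hi⟩ := Finite.exists_max x.2
  obtain ⟨j, hj⟩ := Finite.exists_min x.1
  exact ⟨(fun l => x.1 l + if l = i then 1 else 0, fun l => x.2 l + if l = j then 1 else 0),
    i, j, hi, hj, fun _ => rfl, fun _ => rfl⟩

/-- Sequences whose first `T` steps are valid agree up to step `T` with a dynamic. -/
lemma exists_isDynamic_extending {n : ℕ} [NeZero n] (U V : ℕ → Fin n → ℕ) (T : ℕ)
    (hU : ∀ l, U 0 l = 0) (hV : ∀ l, V 0 l = 0)
    (h : ∀ t < T, IsStep (U t) (V t) (U (t + 1)) (V (t + 1))) :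
    ∃ U' V' : ℕ → Fin n → ℕ, IsDynamic n U' V' ∧ ∀ t ≤ T, U' t = U t ∧ V' t = V t := by
  choose next hnext using exists_isStep (n := n)
  let X : ℕ → (Fin n → ℕ) × (Fin n → ℕ) := fun t =>
    if t ≤ T then (U t, V t) else next^[t - T] (U T, V T)
  have hX : ∀ t ≤ T, X t = (U t, V t) := fun t ht => if_pos ht
  refine ⟨fun t => (X t).1, fun t => (X t).2, ⟨?_, ?_, fun t => ?_⟩, fun t ht => ?_⟩
  · simpa [hX 0 T.zero_le] using hU
  · simpa [hX 0 T.zero_le] using hV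
  · change IsStep (X t).1 (X t).2 (X (t + 1)).1 (X (t + 1)).2
    rcases lt_or_ge t T with ht | ht
    · rw [hX t ht.le, hX (t + 1) ht]
      exact h t ht
    · have key : ∀ k, X (T + k) = next^[k] (U T, V T) := by
        rintro (_ | k)
        · simp [X]
        · simp [X]
      obtain ⟨k, rfl⟩ := Nat.exists_eq_add_of_le ht
      rw [add_assoc, key, key, Function.iterate_succ_apply']
      exact hnext _
  · simp [hX t ht]

/-- A step on `n` components lifts to `n + 1` components, after shifting by `P` and `Q`, when the
last component is neither needed for the minimum of `u` nor for the maximum of `v`. -/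
lemma IsStep.snoc {n : ℕ} {u v u' v' : Fin n → ℕ} (h : IsStep u v u' v') (P Q R : ℕ)
    (hu : ∀ i, u i ≤ R) :
    IsStep (Fin.snoc (α := fun _ => ℕ) (fun i => P + u i) (P + R))
      (Fin.snoc (α := fun _ => ℕ) (fun i => Q + v i) Q)
      (Fin.snoc (α := fun _ => ℕ) (fun i => P + u' i) (P + R))
      (Fin.snoc (α := fun _ => ℕ) (fun i => Q + v' i) Q) := by
  obtain ⟨i, j, hi, hj, hu', hv'⟩ := h
  refine ⟨i.castSucc, j.castSucc, fun l => ?_, fun l => ?_, fun l => ?_, fun l => ?_⟩ <;>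
    induction l using Fin.lastCases with
    | last => simp [hu, (Fin.castSucc_lt_last _).ne']
    | cast l => simp [hi, hj, hu', hv', add_assoc]

/-- The copying construction: if `(U, V)` is a dynamic for `I_{n+1}` with
`V(t₀)` constant equal to `Q` and `U(t₀)` equal to `P` in its first `n`
components and `P + R` in its last, and `(Û, V̂)` is a dynamic for `Iₙ` whose
`U`-components stay `≤ R` up to step `s₀`, then there is a dynamic `(U', V')`
for `I_{n+1}` agreeing with `(U, V)` up to step `t₀` which copies `(Û, V̂)` in
its first `n` components (shifted by `P` resp. `Q`) for `s₀` steps, keeping the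
last components fixed at `P + R` and `Q`. -/
theorem stmt_12 (n : ℕ) (hn : 2 ≤ n)
    (U V : ℕ → Fin (n + 1) → ℕ) (hUV : IsDynamic (n + 1) U V)
    (t₀ P Q R : ℕ)
    (hV : ∀ l, V t₀ l = Q)
    (hU : ∀ i : Fin n, U t₀ i.castSucc = P)
    (hUlast : U t₀ (Fin.last n) = P + R)
    (Uh Vh : ℕ → Fin n → ℕ) (hUVh : IsDynamic n Uh Vh)
    (s₀ : ℕ) (hbound : ∀ s, s ≤ s₀ → ∀ i, Uh s i ≤ R) :
    ∃ U' V' : ℕ → Fin (n + 1) → ℕ, IsDynamic (n + 1) U' V' ∧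
      (∀ t, t ≤ t₀ → ∀ l, U' t l = U t l ∧ V' t l = V t l) ∧
      (∀ s, s ≤ s₀ →
        (∀ i : Fin n,
          U' (t₀ + s) i.castSucc = P + Uh s i ∧
          V' (t₀ + s) i.castSucc = Q + Vh s i) ∧
        U' (t₀ + s) (Fin.last n) = P + R ∧
        V' (t₀ + s) (Fin.last n) = Q) := by
  let A : ℕ → Fin (n + 1) → ℕ := fun s => Fin.snoc (α := fun _ => ℕ) (fun i => P + Uh s i) (P + R)
  let B : ℕ → Fin (n + 1) → ℕ := fun s => Fin.snoc (α := fun _ => ℕ) (fun i => Q + Vh s i) Q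
  let U₁ : ℕ → Fin (n + 1) → ℕ := fun t => if t ≤ t₀ then U t else A (t - t₀)
  let V₁ : ℕ → Fin (n + 1) → ℕ := fun t => if t ≤ t₀ then V t else B (t - t₀)
  have hU₁ : ∀ t ≤ t₀, U₁ t = U t := fun t ht => if_pos ht
  have hV₁ : ∀ t ≤ t₀, V₁ t = V t := fun t ht => if_pos ht
  have hA0 : U t₀ = A 0 := by
    funext l
    induction l using Fin.lastCases with
    | last => simp [A, hUlast]
    | cast l => simp [A, hU, hUVh.1]
  have hB0 : V t₀ = B 0 := by
    funext l
    induction l using Fin.lastCases with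
    | last => simp [B, hV]
    | cast l => simp [B, hV, hUVh.2.1]
  have hA : ∀ s, U₁ (t₀ + s) = A s := by
    rintro (_ | s)
    · simp [U₁, hA0]
    · simp [U₁]
  have hB : ∀ s, V₁ (t₀ + s) = B s := by
    rintro (_ | s)
    · simp [V₁, hB0]
    · simp [V₁]
  obtain ⟨U', V', hdyn, hagree⟩ := exists_isDynamic_extending U₁ V₁ (t₀ + s₀)
    (by simpa [hU₁ 0 t₀.zero_le] using hUV.1) (by simpa [hV₁ 0 t₀.zero_le] using hUV.2.1)
    (fun t ht => by
      rcases lt_or_ge t t₀ with h | h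
      · rw [hU₁ t h.le, hV₁ t h.le, hU₁ (t + 1) h, hV₁ (t + 1) h]
        exact hUV.2.2 t
      · obtain ⟨s, rfl⟩ := Nat.exists_eq_add_of_le h
        rw [add_assoc, hA, hB, hA, hB]
        exact IsStep.snoc (hUVh.2.2 s) P Q R (hbound s (by omega)))
  refine ⟨U', V', hdyn, fun t ht l => ?_, fun s hs => ?_⟩
  · obtain ⟨h1, h2⟩ := hagree t (by omega)
    rw [h1, h2, hU₁ t ht, hV₁ t ht]
    exact ⟨rfl, rfl⟩
  · obtain ⟨h1, h2⟩ := hagree (t₀ + s) (by omega)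
    rw [h1, h2, hA, hB]
    simp [A, B]
end

section
/- In the setting of the copying construction — (U',V') a dynamic for I_{n+1} with U'(t₀+s) equal to P + Û_i(s) in components i ≤ n and P + R in component n+1, and V'(t₀+s) equal to Q + V̂_i(s) in components i ≤ n and Q in component n+1, where (Û,V̂) is a dynamic for I_n — if additionally min_i Û_i(s₀) ≤ R and max_i V̂_i(s₀) ≥ 0, then the gap satisfies gap_{(U',V')}(t₀+s₀) = (Q − P) + (max_i V̂_i(s₀) − min_i Û_i(s₀)); that is, the gap of the I_{n+1} dynamic increases from step t₀ to step t₀+s₀ by exactly the gap of the copied I_n dynamic at step s₀. -/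
/-- In the setting of the copying construction, if `min_i Û_i(s₀) ≤ R` and
`max_i V̂_i(s₀) ≥ 0`, then the gap of the `I_{n+1}` dynamic at step `t₀ + s₀`
equals `(Q − P)` plus the gap of the copied `Iₙ` dynamic at step `s₀`: the gap
increases from step `t₀` to step `t₀ + s₀` by exactly the gap of the copied
dynamic. -/
theorem stmt_13 (n : ℕ) (hn : 1 ≤ n)
    (U' V' : ℕ → Fin (n + 1) → ℕ) (hUV' : IsDynamic (n + 1) U' V')
    (Uh Vh : ℕ → Fin n → ℕ) (hUVh : IsDynamic n Uh Vh)
    (t₀ s₀ P Q R : ℕ)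
    (hcopy : ∀ s, s ≤ s₀ →
      (∀ i : Fin n,
        U' (t₀ + s) i.castSucc = P + Uh s i ∧
        V' (t₀ + s) i.castSucc = Q + Vh s i) ∧
      U' (t₀ + s) (Fin.last n) = P + R ∧
      V' (t₀ + s) (Fin.last n) = Q)
    (hmin : (⨅ i, Uh s₀ i) ≤ R)
    (hmax : 0 ≤ ⨆ i, Vh s₀ i) :
    gap (n + 1) U' V' (t₀ + s₀) = ((Q : ℤ) - (P : ℤ)) + gap n Uh Vh s₀ := by
  have : Nonempty (Fin n) := ⟨⟨0, hn⟩⟩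
  obtain ⟨hcast, hUlast, hVlast⟩ := hcopy s₀ le_rfl
  have hsup : (⨆ l, V' (t₀ + s₀) l) = Q + ⨆ i, Vh s₀ i := by
    obtain ⟨k, hk⟩ := exists_eq_ciSup_of_finite (f := Vh s₀)
    apply le_antisymm
    · refine ciSup_le fun l => ?_
      induction l using Fin.lastCases with
      | last => rw [hVlast]; exact Nat.le_add_right _ _
      | cast i =>
        rw [(hcast i).2]
        exact Nat.add_le_add_left (le_ciSup (Finite.bddAbove_range (Vh s₀)) i) Q
    · rw [← hk, ← (hcast k).2]
      exact le_ciSup (Finite.bddAbove_range (V' (t₀ + s₀))) k.castSucc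
  have hinf : (⨅ l, U' (t₀ + s₀) l) = P + ⨅ i, Uh s₀ i := by
    obtain ⟨k, hk⟩ := exists_eq_ciInf_of_finite (f := Uh s₀)
    apply le_antisymm
    · rw [← hk, ← (hcast k).1]
      exact ciInf_le (OrderBot.bddBelow _) k.castSucc
    · refine le_ciInf fun l => ?_
      induction l using Fin.lastCases with
      | last => rw [hUlast]; exact Nat.add_le_add_left hmin P
      | cast i =>
        rw [(hcast i).1]
        exact Nat.add_le_add_left (ciInf_le (OrderBot.bddBelow _) i) P
  simp only [gap, hsup, hinf]
  push_cast
  ring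
end
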